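/- Let 2<p<∞. Then there is a constant c₅>0 depending only on p such that for every nonnegative ζ ∈ L^p(Π) ∩ L¹(Π): (a) ∫_Π |∇ₓ G(x,y)| ζ(y) dy ≤ c₅ (‖ζ‖_p + ‖ζ‖₁) for every x ∈ Π, so that Gζ is Lipschitz on Π with Lipschitz constant at most c₅(‖ζ‖_p + ‖ζ‖₁); and (b) Gζ(x) ≤ c₅ x₂ (‖ζ‖_p + ‖ζ‖₁) for every x = (x₁,x₂) ∈ Π. -/

import Mathlib

open MeasureTheory Real Filter Topology

noncomputable section

/-- The open upper half-plane Π. -/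
def UHP : Set (ℝ × ℝ) := {x | 0 < x.2}

/-- Planar Lebesgue measure restricted to the upper half-plane. -/
def μUH : Measure (ℝ × ℝ) := MeasureTheory.volume.restrict UHP

/-- Squared Euclidean distance in the plane. -/
def sqdist (x y : ℝ × ℝ) : ℝ := (x.1 - y.1) ^ 2 + (x.2 - y.2) ^ 2

/-- Euclidean distance in the plane. -/
def euclDist (x y : ℝ × ℝ) : ℝ := Real.sqrt (sqdist x y)

/-- The Green's function of −Δ in the upper half-plane:
`G(x,y) = (1/(4π)) log(1 + 4 x₂ y₂ / |x−y|²)`. -/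
def greenG (x y : ℝ × ℝ) : ℝ :=
  (4 * π)⁻¹ * Real.log (1 + 4 * x.2 * y.2 / sqdist x y)

/-- The stream-function operator `𝒢ζ(x) = ∫_Π G(x,y) ζ(y) dy`. -/
def Gop (ζ : ℝ × ℝ → ℝ) (x : ℝ × ℝ) : ℝ := ∫ y, greenG x y * ζ y ∂μUH

/-- Kinetic energy `E(ζ) = (1/2) ∫_Π ζ 𝒢ζ`. -/
def energy (ζ : ℝ × ℝ → ℝ) : ℝ := (1 / 2) * ∫ x, ζ x * Gop ζ x ∂μUH

/-- Impulse `I(ζ) = ∫_Π ζ(y) y₂ dy`. -/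
def impulse (ζ : ℝ × ℝ → ℝ) : ℝ := ∫ y, ζ y * y.2 ∂μUH

/-- The `L^p(Π)` norm, as a real number. -/
def lpN (p : ℝ) (ζ : ℝ × ℝ → ℝ) : ℝ := (eLpNorm ζ (ENNReal.ofReal p) μUH).toReal

/-- `f ⪯ g` : `∫ (f−a)₊ ≤ ∫ (g−a)₊` for every `a > 0`. -/
def prec (f g : ℝ × ℝ → ℝ) : Prop :=
  ∀ a : ℝ, 0 < a → ∫ x, max (f x - a) 0 ∂μUH ≤ ∫ x, max (g x - a) 0 ∂μUH

/-- `f` is a rearrangement of `g` on Π. -/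
def IsRearr (f g : ℝ × ℝ → ℝ) : Prop :=
  ∀ a : ℝ, 0 < a → μUH {x | a < f x} = μUH {x | a < g x}

/-- Membership of the relaxed constraint class `𝒲(ζ₀)`. -/
def memW (ζ₀ ζ : ℝ × ℝ → ℝ) : Prop :=
  (∀ x, 0 ≤ ζ x) ∧ Integrable ζ μUH ∧ prec ζ ζ₀

/-- `𝒲(ζ₀, ≤ i₀)`. -/
def Wle (ζ₀ : ℝ × ℝ → ℝ) (i₀ : ℝ) : Set (ℝ × ℝ → ℝ) :=
  {ζ | memW ζ₀ ζ ∧ impulse ζ ≤ i₀}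

/-- `𝒲(ζ₀, i₀)`. -/
def Weq (ζ₀ : ℝ × ℝ → ℝ) (i₀ : ℝ) : Set (ℝ × ℝ → ℝ) :=
  {ζ | memW ζ₀ ζ ∧ impulse ζ = i₀}

/-- Membership of `ℛ⁺(ζ₀)`: restrictions of rearrangements of `ζ₀`. -/
def memRplus (ζ₀ ζ : ℝ × ℝ → ℝ) : Prop :=
  ∃ ξ : ℝ × ℝ → ℝ, ∃ A : Set (ℝ × ℝ), IsRearr ξ ζ₀ ∧ MeasurableSet A ∧
    ζ = A.indicator ξ

/-- Steiner symmetry about the `x₂`-axis. -/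
def SteinerSym (ζ : ℝ × ℝ → ℝ) : Prop :=
  ∀ᵐ t ∂(MeasureTheory.volume.restrict (Set.Ioi (0 : ℝ))),
    (∀ s : ℝ, ζ (-s, t) = ζ (s, t)) ∧
    (∀ s₁ s₂ : ℝ, 0 ≤ s₁ → s₁ ≤ s₂ → ζ (s₂, t) ≤ ζ (s₁, t))

/-- The decreasing rearrangement `ζ^Δ(s) = inf {a > 0 : |{ζ > a}| ≤ s}`. -/
def decRearr (ζ : ℝ × ℝ → ℝ) (s : ℝ) : ℝ :=
  sInf {a : ℝ | 0 < a ∧ μUH {x | a < ζ x} ≤ ENNReal.ofReal s}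

/-- The norm `‖ζ‖_{𝔛^p} = |I(ζ)| + ‖ζ‖₁ + ‖ζ‖_p`. -/
def XpNorm (p : ℝ) (ζ : ℝ × ℝ → ℝ) : ℝ := |impulse ζ| + lpN 1 ζ + lpN p ζ

/-- Distance to a set of functions in the `𝔛^p` norm. -/
def XpDist (p : ℝ) (ζ : ℝ × ℝ → ℝ) (S : Set (ℝ × ℝ → ℝ)) : ℝ :=
  sInf ((fun σ => XpNorm p fun x => ζ x - σ x) '' S)


/-- Reflection in the `x₁`-axis. -/
def reflPt (y : ℝ × ℝ) : ℝ × ℝ := (y.1, -y.2)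

/-- The gradient in `x` of the Green's function:
`∇ₓG(x,y) = (1/(2π)) ((x−y)/|x−y|² − (x−ȳ)/|x−ȳ|²)`. -/
def gradGx (x y : ℝ × ℝ) : ℝ × ℝ :=
  (2 * π)⁻¹ • ((sqdist x y)⁻¹ • (x - y) - (sqdist x (reflPt y))⁻¹ • (x - reflPt y))

/-- Euclidean norm of a planar vector. -/
def euclNorm (v : ℝ × ℝ) : ℝ := Real.sqrt (v.1 ^ 2 + v.2 ^ 2)

/-- Truncated kernel. -/
def hker (z : ℝ × ℝ) : ℝ := (Set.Iic (1:ℝ)).indicator (fun r : ℝ => r⁻¹) ‖z‖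

lemma hker_meas : Measurable hker := by
  unfold hker
  exact (measurable_inv.indicator measurableSet_Iic).comp measurable_norm

lemma hker_nonneg (z : ℝ × ℝ) : 0 ≤ hker z := by
  unfold hker
  by_cases h : ‖z‖ ∈ Set.Iic (1:ℝ)
  · rw [Set.indicator_of_mem h]; positivity
  · rw [Set.indicator_of_notMem h]

lemma inv_norm_le_hker (z : ℝ × ℝ) : ‖z‖⁻¹ ≤ hker z + 1 := by
  unfold hker
  by_cases h : ‖z‖ ≤ 1
  · rw [Set.indicator_of_mem (show ‖z‖ ∈ Set.Iic (1:ℝ) from h)]; linarith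
  · rw [Set.indicator_of_notMem (show ‖z‖ ∉ Set.Iic (1:ℝ) from h)]
    have := inv_le_one_of_one_le₀ (not_le.mp h).le
    linarith

lemma hker_memLp (q : ℝ) (h1 : 1 < q) (h2 : q < 2) :
    MemLp hker (ENNReal.ofReal q) volume := by
  have hq0 : 0 < q := by linarith
  rw [← integrable_norm_rpow_iff hker_meas.aestronglyMeasurable (by simpa using hq0) (by simp),
    ENNReal.toReal_ofReal hq0.le]
  have key : Integrable (fun z : ℝ × ℝ =>
      (fun r : ℝ => (Set.Iic (1:ℝ)).indicator (fun r : ℝ => r ^ (-q)) r) ‖z‖) volume := by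
    rw [integrable_fun_norm_addHaar]
    have hd : Module.finrank ℝ (ℝ × ℝ) = 2 := by simp
    rw [hd]
    have hI : IntegrableOn (fun r : ℝ => r ^ (1 - q)) (Set.Ioc 0 1) := by
      have := (intervalIntegral.intervalIntegrable_rpow' (a := 0) (b := 1)
        (r := 1 - q) (by linarith))
      rwa [intervalIntegrable_iff_integrableOn_Ioc_of_le zero_le_one] at this
    have hI2 : IntegrableOn ((Set.Iic (1:ℝ)).indicator (fun r : ℝ => r ^ (1 - q)))
        (Set.Ioi 0) := by
      rw [IntegrableOn, integrable_indicator_iff measurableSet_Iic, IntegrableOn,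
        Measure.restrict_restrict measurableSet_Iic, Set.inter_comm, Set.Ioi_inter_Iic]
      exact hI
    refine hI2.congr_fun ?_ measurableSet_Ioi
    intro r hr
    have hr0 : (0:ℝ) < r := hr
    by_cases h : r ∈ Set.Iic (1:ℝ)
    · simp only [Set.indicator_of_mem h]
      simp only [smul_eq_mul]
      rw [sub_eq_add_neg, Real.rpow_add hr0]; simp
    · simp [Set.indicator_of_notMem h]
  refine key.congr (Filter.Eventually.of_forall fun z => ?_)
  simp only [hker]
  by_cases h : ‖z‖ ∈ Set.Iic (1:ℝ)
  · simp only [Set.indicator_of_mem h]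
    rw [Real.norm_of_nonneg (by positivity), Real.inv_rpow (norm_nonneg _),
      Real.rpow_neg (norm_nonneg _)]
  · simp only [Set.indicator_of_notMem h]
    simp [Real.zero_rpow hq0.ne']

lemma kernel_bound (p : ℝ) (hp : 2 < p) : ∃ C : ℝ, 0 < C ∧
    ∀ ζ : ℝ × ℝ → ℝ, (∀ x, 0 ≤ ζ x) →
        MemLp ζ (ENNReal.ofReal p) μUH → Integrable ζ μUH → ∀ x : ℝ × ℝ,
        Integrable (fun y => ‖x - y‖⁻¹ * ζ y) μUH ∧
        ∫ y, ‖x - y‖⁻¹ * ζ y ∂μUH ≤ C * (lpN p ζ + lpN 1 ζ) := by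
  set q : ℝ := p / (p - 1) with hq
  have hp1 : 0 < p - 1 := by linarith
  have hq1 : 1 < q := by rw [hq, lt_div_iff₀ hp1]; linarith
  have hq2 : q < 2 := by rw [hq, div_lt_iff₀ hp1]; linarith
  have hh := hker_memLp q hq1 hq2
  have hconj : q.HolderConjugate p := (Real.HolderConjugate.conjExponent (by linarith)).symm
  refine ⟨(eLpNorm hker (ENNReal.ofReal q) volume).toReal + 1, by positivity, ?_⟩
  intro ζ h0 hζp hζ1 x
  have : (ENNReal.ofReal q).HolderConjugate (ENNReal.ofReal p) := hconj.ennrealOfReal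
  have hmp : MeasurePreserving (fun y : ℝ × ℝ => x - y) volume volume :=
    Measure.measurePreserving_sub_left volume x
  have hx : MemLp (fun y => hker (x - y)) (ENNReal.ofReal q) volume :=
    hh.comp_measurePreserving hmp
  have hxn : eLpNorm (fun y => hker (x - y)) (ENNReal.ofReal q) volume
      = eLpNorm hker (ENNReal.ofReal q) volume :=
    eLpNorm_comp_measurePreserving hh.1 hmp
  have hx' : MemLp (fun y => hker (x - y)) (ENNReal.ofReal q) μUH := hx.restrict _
  have hxn' : eLpNorm (fun y => hker (x - y)) (ENNReal.ofReal q) μUH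
      ≤ eLpNorm hker (ENNReal.ofReal q) volume := by
    rw [← hxn]; exact eLpNorm_mono_measure _ Measure.restrict_le_self
  have hint : Integrable (fun y => hker (x - y) * ζ y) μUH := by
    have := hx'.integrable_mul hζp
    exact this
  have hol : ∫ y, hker (x - y) * ζ y ∂μUH
      ≤ (eLpNorm hker (ENNReal.ofReal q) volume).toReal * lpN p ζ := by
    have e1 : ∫ y, hker (x - y) * ζ y ∂μUH
        = (eLpNorm (fun y => hker (x - y) * ζ y) 1 μUH).toReal := by
      rw [eLpNorm_one_eq_lintegral_enorm, ← integral_norm_eq_lintegral_enorm hint.1]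
      refine integral_congr_ae (Filter.Eventually.of_forall fun y => ?_)
      exact (Real.norm_of_nonneg (mul_nonneg (hker_nonneg _) (h0 y))).symm
    rw [e1, lpN, ← ENNReal.toReal_mul]
    refine ENNReal.toReal_mono (ENNReal.mul_ne_top hh.2.ne hζp.2.ne) ?_
    calc eLpNorm (fun y => hker (x - y) * ζ y) 1 μUH
        ≤ eLpNorm (fun y => hker (x - y)) (ENNReal.ofReal q) μUH
          * eLpNorm ζ (ENNReal.ofReal p) μUH :=
          eLpNorm_smul_le_mul_eLpNorm (φ := fun y => hker (x - y)) hζp.1 hx'.1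
      _ ≤ _ := by gcongr
  have l1 : ∫ y, ζ y ∂μUH = lpN 1 ζ := by
    rw [lpN, ENNReal.ofReal_one, eLpNorm_one_eq_lintegral_enorm,
      ← integral_norm_eq_lintegral_enorm hζ1.1]
    refine integral_congr_ae (Filter.Eventually.of_forall fun y => ?_)
    exact (Real.norm_of_nonneg (h0 y)).symm
  have hle : ∀ y, ‖x - y‖⁻¹ * ζ y ≤ hker (x - y) * ζ y + ζ y := fun y => by
    have := mul_le_mul_of_nonneg_right (inv_norm_le_hker (x - y)) (h0 y)
    linarith
  have hn : ∀ y, 0 ≤ ‖x - y‖⁻¹ * ζ y := fun y => mul_nonneg (by positivity) (h0 y)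
  have hI : Integrable (fun y => ‖x - y‖⁻¹ * ζ y) μUH := by
    refine (hint.add hζ1).mono' ?_ (Filter.Eventually.of_forall fun y => ?_)
    · exact (Measurable.aestronglyMeasurable (by fun_prop)).mul hζ1.1
    · rw [Real.norm_of_nonneg (hn y)]; exact hle y
  refine ⟨hI, ?_⟩
  calc ∫ y, ‖x - y‖⁻¹ * ζ y ∂μUH ≤ ∫ y, hker (x - y) * ζ y + ζ y ∂μUH :=
        integral_mono hI (hint.add hζ1) hle
    _ = ∫ y, hker (x - y) * ζ y ∂μUH + lpN 1 ζ := by rw [integral_add hint hζ1, l1]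
    _ ≤ (eLpNorm hker (ENNReal.ofReal q) volume).toReal * lpN p ζ + lpN 1 ζ := by linarith
    _ ≤ _ := by
      have a1 : 0 ≤ lpN p ζ := ENNReal.toReal_nonneg
      have a2 : 0 ≤ lpN 1 ζ := ENNReal.toReal_nonneg
      have a3 : 0 ≤ (eLpNorm hker (ENNReal.ofReal q) volume).toReal := ENNReal.toReal_nonneg
      nlinarith [mul_nonneg a3 a2]

lemma norm_le_euclNorm (v : ℝ × ℝ) : ‖v‖ ≤ euclNorm v := by
  unfold euclNorm
  rw [Prod.norm_def]
  refine max_le ?_ ?_ <;> rw [Real.norm_eq_abs] <;> apply Real.abs_le_sqrt <;> nlinarith [sq_nonneg v.1, sq_nonneg v.2]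

lemma euclNorm_eq (v : ℝ × ℝ) : euclNorm v = ‖(⟨v.1, v.2⟩ : ℂ)‖ := by
  rw [euclNorm, Complex.norm_eq_sqrt_sq_add_sq]

lemma euclNorm_sub_le (v w : ℝ × ℝ) : euclNorm (v - w) ≤ euclNorm v + euclNorm w := by
  simp only [euclNorm_eq]
  exact norm_sub_le (⟨v.1, v.2⟩ : ℂ) ⟨w.1, w.2⟩

lemma euclNorm_smul (c : ℝ) (hc : 0 ≤ c) (v : ℝ × ℝ) : euclNorm (c • v) = c * euclNorm v := by
  unfold euclNorm
  have : (c • v).1 ^ 2 + (c • v).2 ^ 2 = c ^ 2 * (v.1 ^ 2 + v.2 ^ 2) := by simp; ring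
  rw [this, Real.sqrt_mul (sq_nonneg c), Real.sqrt_sq hc]

lemma euclDist_eq (x y : ℝ × ℝ) : euclDist x y = euclNorm (x - y) := rfl

lemma sqdist_eq (x y : ℝ × ℝ) : sqdist x y = euclDist x y ^ 2 := by
  rw [euclDist, Real.sq_sqrt]; unfold sqdist; positivity

lemma euclDist_nonneg' (x y : ℝ × ℝ) : 0 ≤ euclDist x y := Real.sqrt_nonneg _

lemma norm_le_euclDist (x y : ℝ × ℝ) : ‖x - y‖ ≤ euclDist x y := norm_le_euclNorm _

lemma euclDist_pos {x y : ℝ × ℝ} (h : y ≠ x) : 0 < euclDist x y :=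
  lt_of_lt_of_le (norm_pos_iff.mpr (sub_ne_zero.mpr h.symm)) (norm_le_euclDist x y)

lemma euclDist_le_refl {x y : ℝ × ℝ} (hx : 0 < x.2) (hy : 0 < y.2) :
    euclDist x y ≤ euclDist x (reflPt y) := by
  unfold euclDist sqdist reflPt
  apply Real.sqrt_le_sqrt
  simp only
  nlinarith [mul_pos hx hy]

lemma inv_eucl_le {x y : ℝ × ℝ} (h : y ≠ x) : (euclDist x y)⁻¹ ≤ ‖x - y‖⁻¹ :=
  inv_anti₀ (norm_pos_iff.mpr (sub_ne_zero.mpr h.symm)) (norm_le_euclDist x y)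

lemma inv_refl_le {x y : ℝ × ℝ} (hx : 0 < x.2) (hy : 0 < y.2) (h : y ≠ x) :
    (euclDist x (reflPt y))⁻¹ ≤ ‖x - y‖⁻¹ :=
  (inv_anti₀ (euclDist_pos h) (euclDist_le_refl hx hy)).trans (inv_eucl_le h)

lemma two_pi_inv : (2 * π)⁻¹ ≤ 1 / 6 := by
  rw [one_div]
  exact inv_anti₀ (by norm_num) (by linarith [Real.pi_gt_three])

lemma aux_inv (x y : ℝ × ℝ) :
    euclNorm ((sqdist x y)⁻¹ • (x - y)) = (euclDist x y)⁻¹ := by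
  rw [euclNorm_smul _ (by rw [sqdist_eq]; positivity), sqdist_eq, ← euclDist_eq]
  rcases eq_or_ne (euclDist x y) 0 with h | h
  · simp [h]
  · field_simp

lemma grad_le {x y : ℝ × ℝ} (hx : 0 < x.2) (hy : 0 < y.2) (h : y ≠ x) :
    euclNorm (gradGx x y) ≤ ‖x - y‖⁻¹ := by
  unfold gradGx
  rw [euclNorm_smul _ (by positivity)]
  have h1 := euclNorm_sub_le ((sqdist x y)⁻¹ • (x - y))
    ((sqdist x (reflPt y))⁻¹ • (x - reflPt y))
  rw [aux_inv, aux_inv] at h1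
  have h2 := inv_eucl_le h
  have h3 := inv_refl_le hx hy h
  have h4 := two_pi_inv
  have h5 : 0 ≤ euclNorm ((sqdist x y)⁻¹ • (x - y) -
    (sqdist x (reflPt y))⁻¹ • (x - reflPt y)) := Real.sqrt_nonneg _
  have h6 : 0 ≤ ‖x - y‖⁻¹ := by positivity
  nlinarith [mul_le_mul_of_nonneg_right h4 h5]

lemma green_nonneg {x y : ℝ × ℝ} (hx : 0 < x.2) (hy : 0 < y.2) : 0 ≤ greenG x y := by
  unfold greenG
  have : 0 ≤ 4 * x.2 * y.2 / sqdist x y := by rw [sqdist_eq]; positivity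
  exact mul_nonneg (by positivity) (Real.log_nonneg (by linarith))

lemma green_eq {x y : ℝ × ℝ} (hx : 0 < x.2) (hy : 0 < y.2) (h : y ≠ x) :
    greenG x y = (2 * π)⁻¹ * (Real.log (euclDist x (reflPt y)) - Real.log (euclDist x y)) := by
  have d := euclDist_pos h
  have d' := d.trans_le (euclDist_le_refl hx hy)
  have e : 1 + 4 * x.2 * y.2 / sqdist x y
      = (euclDist x (reflPt y) / euclDist x y) ^ 2 := by
    rw [div_pow, ← sqdist_eq, ← sqdist_eq]
    have : sqdist x y ≠ 0 := by rw [sqdist_eq]; positivity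
    field_simp
    simp only [sqdist, reflPt]; ring
  rw [greenG, e, Real.log_pow, Real.log_div d'.ne' d.ne']
  push_cast
  field_simp
  ring

lemma green_le {x y : ℝ × ℝ} (hx : 0 < x.2) (hy : 0 < y.2) (h : y ≠ x) :
    greenG x y ≤ x.2 * ‖x - y‖⁻¹ := by
  have d := euclDist_pos h
  rw [green_eq hx hy h, ← Real.log_div (d.trans_le (euclDist_le_refl hx hy)).ne' d.ne']
  have hr : euclDist x (reflPt y) ≤ euclDist x y + 2 * x.2 := by
    have hy2 : y.2 - x.2 ≤ euclDist x y := by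
      have := (norm_snd_le (x - y)).trans (norm_le_euclDist x y)
      rw [Real.norm_eq_abs] at this
      have := neg_abs_le (x - y).2
      simp only [Prod.snd_sub] at *
      linarith
    have hs := sqdist_eq x y
    have : sqdist x (reflPt y) ≤ (euclDist x y + 2 * x.2) ^ 2 := by
      have e : sqdist x (reflPt y) = sqdist x y + 4 * x.2 * y.2 := by
        simp only [sqdist, reflPt]; ring
      rw [e, hs]
      nlinarith
    exact (Real.sqrt_le_sqrt this).trans_eq (Real.sqrt_sq (by positivity))
  have hl := Real.log_le_sub_one_of_pos (div_pos (d.trans_le (euclDist_le_refl hx hy)) d)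
  have h1 : euclDist x (reflPt y) / euclDist x y - 1 ≤ 2 * x.2 * (euclDist x y)⁻¹ := by
    rw [div_eq_mul_inv]
    have := mul_le_mul_of_nonneg_right hr (inv_nonneg.mpr d.le)
    rw [add_mul, mul_inv_cancel₀ d.ne'] at this
    linarith
  have h2 := mul_le_mul_of_nonneg_left (inv_eucl_le h) hx.le
  have h3 : 0 ≤ x.2 * ‖x - y‖⁻¹ := by positivity
  have h4 := two_pi_inv
  have h5 : 0 < (2 * π)⁻¹ := by positivity
  calc _ ≤ (2 * π)⁻¹ * (2 * (x.2 * ‖x - y‖⁻¹)) := by gcongr; linarith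
    _ ≤ _ := by nlinarith

lemma log_sub_le {a b : ℝ} (ha : 0 < a) (hb : 0 < b) :
    |Real.log a - Real.log b| ≤ |a - b| * (a⁻¹ + b⁻¹) := by
  have k : ∀ a b : ℝ, 0 < a → 0 < b → Real.log a - Real.log b ≤ |a - b| * (a⁻¹ + b⁻¹) := by
    intro a b ha hb
    have h := Real.log_le_sub_one_of_pos (div_pos ha hb)
    rw [Real.log_div ha.ne' hb.ne'] at h
    have e : a / b - 1 = (a - b) * b⁻¹ := by field_simp
    have h1 := mul_le_mul_of_nonneg_right (le_abs_self (a - b)) (inv_pos.mpr hb).le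
    have h2 := mul_nonneg (abs_nonneg (a - b)) (inv_pos.mpr ha).le
    linarith
  rw [abs_le]
  have h1 := k a b ha hb
  have h2 := k b a hb ha
  rw [abs_sub_comm, add_comm] at h2
  constructor <;> linarith

lemma euclDist_sub_le (x z y : ℝ × ℝ) : |euclDist x y - euclDist z y| ≤ euclDist x z := by
  simp only [euclDist_eq, euclNorm_eq]
  refine (abs_norm_sub_norm_le _ _).trans_eq ?_
  congr 1
  apply Complex.ext <;> simp

lemma green_diff {x z y : ℝ × ℝ} (hx : 0 < x.2) (hz : 0 < z.2) (hy : 0 < y.2)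
    (h : y ≠ x) (h' : y ≠ z) :
    |greenG x y - greenG z y| ≤ euclDist x z * (1/2) * (‖x - y‖⁻¹ + ‖z - y‖⁻¹) := by
  rw [green_eq hx hy h, green_eq hz hy h', ← mul_sub, abs_mul,
    abs_of_pos (by positivity : 0 < (2 * π)⁻¹)]
  have a1 := log_sub_le (euclDist_pos h) (euclDist_pos h')
  have a2 := log_sub_le ((euclDist_pos h).trans_le (euclDist_le_refl hx hy))
    ((euclDist_pos h').trans_le (euclDist_le_refl hz hy))
  have D := euclDist_nonneg' x z
  have b1 : |euclDist x y - euclDist z y| * ((euclDist x y)⁻¹ + (euclDist z y)⁻¹)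
      ≤ euclDist x z * (‖x - y‖⁻¹ + ‖z - y‖⁻¹) :=
    mul_le_mul (euclDist_sub_le _ _ _) (add_le_add (inv_eucl_le h) (inv_eucl_le h'))
      (add_nonneg (inv_nonneg.mpr (euclDist_nonneg' _ _))
        (inv_nonneg.mpr (euclDist_nonneg' _ _))) D
  have b2 : |euclDist x (reflPt y) - euclDist z (reflPt y)| *
      ((euclDist x (reflPt y))⁻¹ + (euclDist z (reflPt y))⁻¹)
      ≤ euclDist x z * (‖x - y‖⁻¹ + ‖z - y‖⁻¹) :=
    mul_le_mul (euclDist_sub_le _ _ _) (add_le_add (inv_refl_le hx hy h) (inv_refl_le hz hy h'))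
      (add_nonneg (inv_nonneg.mpr (euclDist_nonneg' _ _))
        (inv_nonneg.mpr (euclDist_nonneg' _ _))) D
  have c : |Real.log (euclDist x (reflPt y)) - Real.log (euclDist x y) -
      (Real.log (euclDist z (reflPt y)) - Real.log (euclDist z y))|
      ≤ 2 * (euclDist x z * (‖x - y‖⁻¹ + ‖z - y‖⁻¹)) := by
    have := abs_sub (Real.log (euclDist x (reflPt y)) - Real.log (euclDist z (reflPt y)))
      (Real.log (euclDist x y) - Real.log (euclDist z y))
    rw [sub_sub_sub_comm]
    linarith
  have E : 0 ≤ euclDist x z * (‖x - y‖⁻¹ + ‖z - y‖⁻¹) := by positivity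
  calc _ ≤ 1/6 * (2 * (euclDist x z * (‖x - y‖⁻¹ + ‖z - y‖⁻¹))) :=
        mul_le_mul two_pi_inv c (abs_nonneg _) (by norm_num)
    _ ≤ _ := by nlinarith

lemma ae_good (x : ℝ × ℝ) : ∀ᵐ y ∂μUH, 0 < y.2 ∧ y ≠ x := by
  have h1 : ∀ᵐ y ∂μUH, y ∈ UHP :=
    ae_restrict_mem (measurableSet_lt measurable_const measurable_snd)
  have h2 : ∀ᵐ y ∂μUH, y ≠ x := ae_restrict_of_ae (Measure.ae_ne volume x)
  filter_upwards [h1, h2] with y a b using ⟨a, b⟩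

lemma green_meas (x : ℝ × ℝ) : Measurable (greenG x) := by
  unfold greenG sqdist
  fun_prop

lemma green_integrable {x : ℝ × ℝ} (hx : 0 < x.2) {ζ : ℝ × ℝ → ℝ} (h0 : ∀ x, 0 ≤ ζ x)
    (hζ : Integrable ζ μUH) (hK : Integrable (fun y => ‖x - y‖⁻¹ * ζ y) μUH) :
    Integrable (fun y => greenG x y * ζ y) μUH := by
  refine (hK.const_mul x.2).mono' ((green_meas x).aestronglyMeasurable.mul hζ.1) ?_
  filter_upwards [ae_good x] with y hy
  rw [Real.norm_of_nonneg (mul_nonneg (green_nonneg hx hy.1) (h0 y)), ← mul_assoc]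
  exact mul_le_mul_of_nonneg_right (green_le hx hy.1 hy.2) (h0 y)

/-- Lemma 3 (strengthening for `p > 2`): gradient bound, Lipschitz bound,
and linear growth of the stream function. -/
theorem stmt_2 (p : ℝ) (hp : 2 < p) :
    ∃ c₅ : ℝ, 0 < c₅ ∧
      ∀ ζ : ℝ × ℝ → ℝ, (∀ x, 0 ≤ ζ x) →
        MemLp ζ (ENNReal.ofReal p) μUH → Integrable ζ μUH →
        (∀ x ∈ UHP, ∫ y, euclNorm (gradGx x y) * ζ y ∂μUH ≤ c₅ * (lpN p ζ + lpN 1 ζ)) ∧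
        (∀ x ∈ UHP, ∀ y ∈ UHP,
          |Gop ζ x - Gop ζ y| ≤ c₅ * (lpN p ζ + lpN 1 ζ) * euclDist x y) ∧
        (∀ x ∈ UHP, Gop ζ x ≤ c₅ * x.2 * (lpN p ζ + lpN 1 ζ)) := by
  obtain ⟨C, hC, H⟩ := kernel_bound p hp
  refine ⟨C, hC, fun ζ h0 hζp hζ1 => ⟨?_, ?_, ?_⟩⟩
  · intro x hx
    obtain ⟨hI, hle⟩ := H ζ h0 hζp hζ1 x
    refine le_trans (integral_mono_of_nonneg
      (Filter.Eventually.of_forall fun y => mul_nonneg (Real.sqrt_nonneg _) (h0 y)) hI ?_) hle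
    filter_upwards [ae_good x] with y hy
    exact mul_le_mul_of_nonneg_right (grad_le hx hy.1 hy.2) (h0 y)
  · intro x hx z hz
    obtain ⟨hI, hle⟩ := H ζ h0 hζp hζ1 x
    obtain ⟨hI', hle'⟩ := H ζ h0 hζp hζ1 z
    rw [Gop, Gop, ← integral_sub (green_integrable hx h0 hζ1 hI) (green_integrable hz h0 hζ1 hI')]
    have hb : ∀ᵐ y ∂μUH, ‖greenG x y * ζ y - greenG z y * ζ y‖ ≤
        euclDist x z * (1/2) * (‖x - y‖⁻¹ * ζ y + ‖z - y‖⁻¹ * ζ y) := by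
      filter_upwards [ae_good x, ae_good z] with y hy hy'
      rw [← sub_mul, Real.norm_eq_abs, abs_mul, abs_of_nonneg (h0 y), ← add_mul, ← mul_assoc]
      exact mul_le_mul_of_nonneg_right (green_diff hx hz hy.1 hy.2 hy'.2) (h0 y)
    have := norm_integral_le_of_norm_le ((hI.add hI').const_mul (euclDist x z * (1/2))) hb
    rw [Real.norm_eq_abs] at this
    refine this.trans ?_
    simp only [Pi.add_apply]
    rw [integral_const_mul, integral_add hI hI']
    have D := euclDist_nonneg' x z
    nlinarith [mul_le_mul_of_nonneg_left (add_le_add hle hle') D]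
  · intro x hx
    obtain ⟨hI, hle⟩ := H ζ h0 hζp hζ1 x
    have h1 : Gop ζ x ≤ ∫ y, x.2 * (‖x - y‖⁻¹ * ζ y) ∂μUH := by
      refine integral_mono_ae (green_integrable hx h0 hζ1 hI) (hI.const_mul x.2) ?_
      filter_upwards [ae_good x] with y hy
      simp only [← mul_assoc]
      exact mul_le_mul_of_nonneg_right (green_le hx hy.1 hy.2) (h0 y)
    rw [integral_const_mul] at h1
    have hx0 : 0 < x.2 := hx
    nlinarith [mul_le_mul_of_nonneg_left hle hx0.le]
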